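/- Let a, b : ℝ → ℝ with a controlled by b (in the sense that |a| ≤ Cb, |a'| ≤ Cb/|ξ|, |a''| ≤ Cb/|ξ|², and b(ξ) ≍ b(ξ') for |ξ| ≍ |ξ'|, b ≥ 0). Then there exists C' such that for |η|, |λ| ≤ |ξ|/4 and ξ ≠ 0, one has |a(ξ + η + λ) − a(ξ + η) − a(ξ + λ) + a(ξ)| ≤ C'·|η||λ|·b(ξ)/|ξ|². -/

import Mathlib

/-- `a` is controlled by `b`: `b` is nonnegative, comparable at comparable
frequencies, and `a` together with its first two derivatives is bounded by
`b(ξ)`, `b(ξ)/|ξ|`, `b(ξ)/|ξ|²` respectively, away from the origin. -/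
structure IsControlledBy (a b : ℝ → ℝ) : Prop where
  smooth_a : ContDiff ℝ (⊤ : ℕ∞) a
  smooth_b : ContDiff ℝ (⊤ : ℕ∞) b
  nonneg : ∀ ξ, 0 ≤ b ξ
  comparable : ∃ c > 0, ∀ ξ ξ' : ℝ, |ξ| ≤ 2 * |ξ'| → |ξ'| ≤ 2 * |ξ| →
      b ξ ≤ c * b ξ'
  bound : ∃ C > 0, ∀ ξ : ℝ, ξ ≠ 0 →
      |a ξ| ≤ C * b ξ ∧
      |deriv a ξ| ≤ C * b ξ / |ξ| ∧
      |deriv (deriv a) ξ| ≤ C * b ξ / |ξ| ^ 2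

theorem double_mean_value_multiplier_bound (a b : ℝ → ℝ)
    (h : IsControlledBy a b) :
    ∃ C' > 0, ∀ ξ η lam : ℝ, ξ ≠ 0 → |η| ≤ |ξ| / 4 → |lam| ≤ |ξ| / 4 →
      |a (ξ + η + lam) - a (ξ + η) - a (ξ + lam) + a ξ| ≤
        C' * |η| * |lam| * b ξ / |ξ| ^ 2 := by
  obtain ⟨c, hc, hcomp⟩ := h.comparable
  obtain ⟨C, hC, hb⟩ := h.bound
  refine ⟨4 * C * c, by positivity, ?_⟩
  intro ξ η lam hξ hη hlam
  have hpos : 0 < |ξ| := abs_pos.mpr hξ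
  have ha : Differentiable ℝ a := h.smooth_a.differentiable (by simp)
  have ha' : Differentiable ℝ (deriv a) := by
    have h2 : ContDiff ℝ (1 + 1) a := h.smooth_a.of_le (by
      rw [one_add_one_eq_two]
      exact WithTop.coe_le_coe.mpr (le_top : (2 : ℕ∞) ≤ ⊤))
    exact (contDiff_succ_iff_deriv.mp h2).2.2.differentiable (by simp)
  set K : ℝ := 4 * C * c * b ξ / |ξ| ^ 2 with hK
  have hbound : ∀ z ∈ Metric.closedBall ξ (|ξ| / 2), ‖deriv (deriv a) z‖ ≤ K := by
    intro z hz
    rw [Metric.mem_closedBall, Real.dist_eq] at hz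
    have h1 : |z| ≤ |z - ξ| + |ξ| := by
      simpa using abs_add_le (z - ξ) ξ
    have h2 : |ξ| ≤ |z - ξ| + |z| := by
      have := abs_add_le (ξ - z) z
      rw [abs_sub_comm ξ z] at this
      simpa using this
    have hzpos : 0 < |z| := by linarith
    have hbz : b z ≤ c * b ξ := hcomp z ξ (by linarith) (by linarith)
    have h3 := (hb z (abs_pos.mp hzpos)).2.2
    rw [Real.norm_eq_abs]
    refine h3.trans ?_
    have hn := h.nonneg ξ
    have hsq : |ξ| ^ 2 ≤ 4 * |z| ^ 2 := by nlinarith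
    rw [hK, div_le_div_iff₀ (by positivity) (by positivity)]
    calc C * b z * |ξ| ^ 2 ≤ C * (c * b ξ) * (4 * |z| ^ 2) := by gcongr
      _ = 4 * C * c * b ξ * |z| ^ 2 := by ring
  have hg : ∀ x, HasDerivAt (fun x => a (x + lam) - a x)
      (deriv a (x + lam) - deriv a x) x := fun x =>
    ((ha (x + lam)).hasDerivAt.comp_add_const x lam).sub (ha x).hasDerivAt
  have hstep : ∀ x ∈ Metric.closedBall ξ (|ξ| / 4),
      ‖deriv a (x + lam) - deriv a x‖ ≤ K * |lam| := by
    intro x hx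
    rw [Metric.mem_closedBall, Real.dist_eq] at hx
    have := (convex_closedBall ξ (|ξ| / 2)).norm_image_sub_le_of_norm_deriv_le
      (f := deriv a) (fun z _ => ha' z) hbound (x := x) (y := x + lam)
      (by rw [Metric.mem_closedBall, Real.dist_eq]; linarith)
      (by
        rw [Metric.mem_closedBall, Real.dist_eq]
        have := abs_add_le (x - ξ) lam
        rw [show x + lam - ξ = x - ξ + lam by ring]
        linarith)
    simpa using this
  have hfin := (convex_closedBall ξ (|ξ| / 4)).norm_image_sub_le_of_norm_hasDerivWithin_le
    (fun x _ => (hg x).hasDerivWithinAt) hstep (x := ξ) (y := ξ + η)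
    (by rw [Metric.mem_closedBall, dist_self]; positivity)
    (by rw [Metric.mem_closedBall, Real.dist_eq]; simpa using hη)
  rw [Real.norm_eq_abs, Real.norm_eq_abs, add_sub_cancel_left] at hfin
  calc |a (ξ + η + lam) - a (ξ + η) - a (ξ + lam) + a ξ|
      = |a (ξ + η + lam) - a (ξ + η) - (a (ξ + lam) - a ξ)| := by
        congr 1; ring
    _ ≤ K * |lam| * |η| := hfin
    _ = 4 * C * c * |η| * |lam| * b ξ / |ξ| ^ 2 := by rw [hK]; ring
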